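/- Let L be a left bialgebroid over B. Then C¹(L,B), the set of extended vertical bisections, is a group under the convolution product (U*V)(X) = U(X₍₁₎)V(X₍₂₎), with unit the counit ε; in particular the convolution inverse U⁻¹ of any U ∈ C¹(L,B) again satisfies U⁻¹(t(b)X) = U⁻¹(X)b, U⁻¹(s(b)X) = b U⁻¹(X) and U⁻¹(X s(b)) = U⁻¹(X t(b)). -/

import Mathlib

open scoped TensorProduct
open TensorProduct

noncomputable section
attribute [local instance] Classical.propDecidable

/-- Choice-based lift of a (bilinear) function to the tensor product: if a linear map agreeing
with `f` on pure tensors exists, this is it (it is then unique); otherwise `0`. -/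
def tlift (R : Type*) [CommRing R] {M N Q : Type*} [AddCommGroup M] [Module R M]
    [AddCommGroup N] [Module R N] [AddCommGroup Q] [Module R Q]
    (f : M → N → Q) : M ⊗[R] N →ₗ[R] Q :=
  if h : ∃ F : M ⊗[R] N →ₗ[R] Q, ∀ x y, F (x ⊗ₜ[R] y) = f x y then h.choose else 0

/-- Choice-based lift of a (bilinear, balanced) function to a quotient of the tensor product. -/
def qtlift (R : Type*) [CommRing R] {M N Q : Type*} [AddCommGroup M] [Module R M]
    [AddCommGroup N] [Module R N] [AddCommGroup Q] [Module R Q]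
    (p : Submodule R (M ⊗[R] N)) (f : M → N → Q) : ((M ⊗[R] N) ⧸ p) →ₗ[R] Q :=
  if h : ∃ F : ((M ⊗[R] N) ⧸ p) →ₗ[R] Q,
      ∀ x y, F (Submodule.Quotient.mk (x ⊗ₜ[R] y)) = f x y then h.choose else 0

variable (k : Type*) [Field k]

/-- Source and target data for a left bialgebroid over `B`: an algebra map `s : B → L` and an
anti-algebra map `t : B → L` with commuting ranges. -/
structure BgdST (B L : Type*) [Ring B] [Algebra k B] [Ring L] [Algebra k L] where
  s : B →ₐ[k] L
  t : B →ₗ[k] L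
  t_one : t 1 = 1
  t_mul : ∀ a b : B, t (a * b) = t b * t a
  st_comm : ∀ a b : B, s a * t b = t b * s a

namespace BgdST

variable {k} {B L : Type*} [Ring B] [Algebra k B] [Ring L] [Algebra k L]
variable (st : BgdST k B L)

/-- The relations defining `L ⊗_B L`: `t a · X ⊗ Y  ~  X ⊗ s a · Y`. -/
def rel : Submodule k (L ⊗[k] L) :=
  Submodule.span k {z | ∃ (a : B) (X Y : L), z = (st.t a * X) ⊗ₜ[k] Y - X ⊗ₜ[k] (st.s a * Y)}

/-- `L ⊗_B L` (the coring tensor square). -/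
abbrev T2 := (L ⊗[k] L) ⧸ st.rel

/-- Class of a pure tensor in `L ⊗_B L`. -/
def mk2 (X Y : L) : st.T2 := Submodule.Quotient.mk (X ⊗ₜ[k] Y)

/-- Evaluate a balanced bilinear expression on an element of `L ⊗_B L`. -/
def lift2 {Q : Type*} [AddCommGroup Q] [Module k Q] (f : L → L → Q) : st.T2 →ₗ[k] Q :=
  qtlift k st.rel f

/-- The relations defining `L ⊗_{B^{op}} L`: `X·t a ⊗ Y ~ X ⊗ t a · Y`. -/
def relOp : Submodule k (L ⊗[k] L) :=
  Submodule.span k {z | ∃ (a : B) (X Y : L), z = (X * st.t a) ⊗ₜ[k] Y - X ⊗ₜ[k] (st.t a * Y)}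

/-- `L ⊗_{B^{op}} L` (domain of the canonical map `λ`). -/
abbrev TOp := (L ⊗[k] L) ⧸ st.relOp

def mkOp (X Y : L) : st.TOp := Submodule.Quotient.mk (X ⊗ₜ[k] Y)

def liftOp {Q : Type*} [AddCommGroup Q] [Module k Q] (f : L → L → Q) : st.TOp →ₗ[k] Q :=
  qtlift k st.relOp f

/-- The relations defining `L ⊗^{B^{op}} L`: `s a · X ⊗ Y ~ X ⊗ Y · s a`. -/
def relA : Submodule k (L ⊗[k] L) :=
  Submodule.span k {z | ∃ (a : B) (X Y : L), z = (st.s a * X) ⊗ₜ[k] Y - X ⊗ₜ[k] (Y * st.s a)}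

/-- `L ⊗^{B^{op}} L` (domain of the canonical map `μ`). -/
abbrev TA := (L ⊗[k] L) ⧸ st.relA

def mkA (X Y : L) : st.TA := Submodule.Quotient.mk (X ⊗ₜ[k] Y)

def liftA {Q : Type*} [AddCommGroup Q] [Module k Q] (f : L → L → Q) : st.TA →ₗ[k] Q :=
  qtlift k st.relA f

/-- Relations for the triple tensor `L ⊗_B L ⊗_B L`. -/
def rel3 : Submodule k (L ⊗[k] (L ⊗[k] L)) :=
  Submodule.span k
    ({z | ∃ (a : B) (X Y Z : L),
        z = (st.t a * X) ⊗ₜ[k] (Y ⊗ₜ[k] Z) - X ⊗ₜ[k] ((st.s a * Y) ⊗ₜ[k] Z)} ∪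
     {z | ∃ (a : B) (X Y Z : L),
        z = X ⊗ₜ[k] ((st.t a * Y) ⊗ₜ[k] Z) - X ⊗ₜ[k] (Y ⊗ₜ[k] (st.s a * Z))})

/-- `L ⊗_B L ⊗_B L`. -/
abbrev T3 := (L ⊗[k] (L ⊗[k] L)) ⧸ st.rel3

def mk3 (X Y Z : L) : st.T3 := Submodule.Quotient.mk (X ⊗ₜ[k] (Y ⊗ₜ[k] Z))

/-- The factorwise product of two elements of `L ⊗_B L`, whenever it is well defined
on representatives (as it is when the left factor lies in the Takeuchi product);
junk value `0` otherwise. -/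
def mulT2 (z w : st.T2) : st.T2 :=
  if h : ∃ u : st.T2, ∀ zr wr : L ⊗[k] L, Submodule.Quotient.mk zr = z →
      Submodule.Quotient.mk wr = w → Submodule.Quotient.mk (zr * wr) = u
  then h.choose else 0

variable (cop : L →ₗ[k] st.T2) (cou : L →ₗ[k] B)

/-- The axioms of a left bialgebroid over `B` with structure `(s,t,Δ,ε) = (st.s, st.t, cop, cou)`
(Definition 2.3 of the paper): `L` is a `B^e`-ring and a `B`-coring, the coproduct corestricts
to an algebra map into the Takeuchi product, and the counit is a left character. -/
structure IsLeftBialgebroid : Prop where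
  comul_one : cop 1 = st.mk2 1 1
  comul_mul : ∀ X Y : L, cop (X * Y) = st.mulT2 (cop X) (cop Y)
  comul_s : ∀ (b : B) (X : L),
    cop (st.s b * X) = st.lift2 (fun x y => st.mk2 (st.s b * x) y) (cop X)
  comul_t : ∀ (b : B) (X : L),
    cop (st.t b * X) = st.lift2 (fun x y => st.mk2 x (st.t b * y)) (cop X)
  takeuchi : ∀ (b : B) (X : L),
    st.lift2 (fun x y => st.mk2 (x * st.t b) y) (cop X) =
      st.lift2 (fun x y => st.mk2 x (y * st.s b)) (cop X)
  coassoc : ∀ X : L,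
    st.lift2 (fun x1 x2 => st.lift2 (fun y1 y2 => st.mk3 x1 y1 y2) (cop x2)) (cop X) =
      st.lift2 (fun x12 x3 => st.lift2 (fun x1 x2 => st.mk3 x1 x2 x3) (cop x12)) (cop X)
  counit_comul_left : ∀ X : L, st.lift2 (fun x1 x2 => st.s (cou x1) * x2) (cop X) = X
  counit_comul_right : ∀ X : L, st.lift2 (fun x1 x2 => st.t (cou x2) * x1) (cop X) = X
  counit_one : cou 1 = 1
  counit_s : ∀ (b : B) (X : L), cou (st.s b * X) = b * cou X
  counit_t : ∀ (b : B) (X : L), cou (st.t b * X) = cou X * b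
  counit_char_s : ∀ X Y : L, cou (X * st.s (cou Y)) = cou (X * Y)
  counit_char_t : ∀ X Y : L, cou (X * st.t (cou Y)) = cou (X * Y)

/-- The canonical map `λ : L ⊗_{B^{op}} L → L ⊗_B L`, `X ⊗ Y ↦ X₍₁₎ ⊗ X₍₂₎Y`. -/
def lam : st.TOp →ₗ[k] st.T2 :=
  st.liftOp (fun X Y => st.lift2 (fun x1 x2 => st.mk2 x1 (x2 * Y)) (cop X))

/-- A left bialgebroid is a left Hopf algebroid if `λ` is bijective. -/
def IsLeftHopf : Prop := Function.Bijective (st.lam cop)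

/-- The canonical map `μ : L ⊗^{B^{op}} L → L ⊗_B L`, `X ⊗ Y ↦ Y₍₁₎X ⊗ Y₍₂₎`. -/
def mu : st.TA →ₗ[k] st.T2 :=
  st.liftA (fun X Y => st.lift2 (fun y1 y2 => st.mk2 (y1 * X) y2) (cop Y))

/-- A left bialgebroid is an anti-left Hopf algebroid if `μ` is bijective. -/
def IsAntiLeftHopf : Prop := Function.Bijective (st.mu cop)

/-- `X₊ ⊗_{B^{op}} X₋ := λ⁻¹(X ⊗_B 1)` (meaningful when `λ` is bijective). -/
def plusMinus (X : L) : st.TOp := Function.invFun (st.lam cop) (st.mk2 X 1)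

/-- `X₍₋₎ ⊗^{B^{op}} X₍₊₎ := μ⁻¹(1 ⊗_B X)` (meaningful when `μ` is bijective). -/
def minusPlus (X : L) : st.TA := Function.invFun (st.mu cop) (st.mk2 1 X)

/-- A left bisection of a left bialgebroid (Definition 3.1). -/
structure IsLeftBisection (σ : L →ₗ[k] B) : Prop where
  unital : σ 1 = 1
  t_prop : ∀ (b : B) (X : L), σ (st.t b * X) = σ X * b
  s_mul : ∀ a b : B, σ (st.s (a * b)) = σ (st.s a) * σ (st.s b)
  s_bij : Function.Bijective (fun b => σ (st.s b))
  prod_t : ∀ X Y : L, σ (X * Y) = σ (X * st.t (σ Y))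
  prod_s : ∀ X Y : L,
    σ (X * Y) = σ (X * st.s (Function.invFun (fun b => σ (st.s b)) (σ Y)))

/-- Convolution of left bisections:  `(σ * η)(X) := σ(s(η(X₍₁₎)) X₍₂₎)`. -/
def bconv (σ η : L →ₗ[k] B) : L →ₗ[k] B :=
  (st.lift2 (fun x1 x2 => σ (st.s (η x1) * x2))).comp cop

/-- A right bisection of a left bialgebroid (Definition 3.6). -/
structure IsRightBisection (σ : L →ₗ[k] B) : Prop where
  unital : σ 1 = 1
  s_prop : ∀ (b : B) (X : L), σ (st.s b * X) = b * σ X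
  t_mul : ∀ a b : B, σ (st.t (a * b)) = σ (st.t b) * σ (st.t a)
  t_bij : Function.Bijective (fun b => σ (st.t b))
  prod_s : ∀ X Y : L, σ (X * Y) = σ (X * st.s (σ Y))
  prod_t : ∀ X Y : L,
    σ (X * Y) = σ (X * st.t (Function.invFun (fun b => σ (st.t b)) (σ Y)))

/-- Convolution of right bisections:  `(σ • η)(X) := σ(t(η(X₍₂₎)) X₍₁₎)`. -/
def rconv (σ η : L →ₗ[k] B) : L →ₗ[k] B :=
  (st.lift2 (fun x1 x2 => σ (st.t (η x2) * x1))).comp cop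

/-- An automorphism `(Φ, φ)` of a left bialgebroid. -/
structure IsBgdAut (Φ : L →ₐ[k] L) (φ : B →ₐ[k] B) : Prop where
  bijL : Function.Bijective Φ
  bijB : Function.Bijective φ
  comp_s : ∀ b : B, Φ (st.s b) = st.s (φ b)
  comp_t : ∀ b : B, Φ (st.t b) = st.t (φ b)
  comp_comul : ∀ X : L,
    cop (Φ X) = st.lift2 (fun x1 x2 => st.mk2 (Φ x1) (Φ x2)) (cop X)
  comp_counit : ∀ X : L, cou (Φ X) = φ (cou X)

/-- `Ad^L_σ(X) := s(σ(X₍₁₎)) X₍₂₎₊ t(σ(X₍₂₎₋))`, for a left Hopf algebroid. -/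
def adL (σ : L →ₗ[k] B) (X : L) : L :=
  st.lift2 (fun x1 x2 => st.s (σ x1) *
    st.liftOp (fun p m => p * st.t (σ m)) (st.plusMinus cop x2)) (cop X)

/-- `Ad^R_σ(X) := t(σ(X₍₂₎)) X₍₁₎₍₊₎ s(σ(X₍₁₎₍₋₎))`, for an anti-left Hopf algebroid. -/
def adR (σ : L →ₗ[k] B) (X : L) : L :=
  st.lift2 (fun x1 x2 => st.t (σ x2) *
    st.liftA (fun m p => p * st.s (σ m)) (st.minusPlus cop x1)) (cop X)

/-- The `B`-bimodule-map conditions on a map `L → B` used for `C¹(L,B)`. -/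
def IsBimodMap (U : L →ₗ[k] B) : Prop :=
  (∀ (b : B) (X : L), U (st.t b * X) = U X * b) ∧
  (∀ (b : B) (X : L), U (st.s b * X) = b * U X)

/-- Convolution `(U * V)(X) = U(X₍₁₎) V(X₍₂₎)` of `B`-valued maps. -/
def cconv (U V : L →ₗ[k] B) : L →ₗ[k] B :=
  (st.lift2 (fun x1 x2 => U x1 * V x2)).comp cop

/-- Extended vertical bisections `C¹(L,B)`: unital convolution-invertible `B`-bimodule maps
`U : L → B` with `U(X s(b)) = U(X t(b))`. -/
def IsC1 (U : L →ₗ[k] B) : Prop :=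
  U 1 = 1 ∧ st.IsBimodMap U ∧
  (∀ (b : B) (X : L), U (X * st.s b) = U (X * st.t b)) ∧
  ∃ V : L →ₗ[k] B, st.IsBimodMap V ∧ st.cconv cop U V = cou ∧ st.cconv cop V U = cou

/-- Convolution product on `B`-bimodule maps `L ⊗_{B^e} L → B`:
`(f ⋆ g)(X,Y) = f(X₍₁₎,Y₍₁₎) g(X₍₂₎,Y₍₂₎)`. -/
def conv2 (f g : L → L → B) (X Y : L) : B :=
  st.lift2 (fun y1 y2 =>
    st.lift2 (fun x1 x2 => f x1 y1 * g x2 y2) (cop X)) (cop Y)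

/-- The unit `ε̃(X ⊗ Y) = ε(XY)` of the convolution algebra. -/
def unit2 (X Y : L) : B := cou (X * Y)

/-- Left-hand side of the 2-cocycle condition: `Γ(X, s(Γ(Y₍₁₎,Z₍₁₎)) Y₍₂₎Z₍₂₎)`. -/
def cocL (Γ : L → L → B) (X Y Z : L) : B :=
  st.lift2 (fun z1 z2 =>
    st.lift2 (fun y1 y2 => Γ X (st.s (Γ y1 z1) * (y2 * z2))) (cop Y)) (cop Z)

/-- Right-hand side of the 2-cocycle condition: `Γ(s(Γ(X₍₁₎,Y₍₁₎)) X₍₂₎Y₍₂₎, Z)`. -/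
def cocR (Γ : L → L → B) (X Y Z : L) : B :=
  st.lift2 (fun y1 y2 =>
    st.lift2 (fun x1 x2 => Γ (st.s (Γ x1 y1) * (x2 * y2)) Z) (cop X)) (cop Y)

/-- Membership of a bilinear map in `_B Hom_B (L ⊗_{B^e} L, B)`. -/
def IsBihom (Γ : L → L → B) : Prop :=
  (∃ Γ' : L →ₗ[k] L →ₗ[k] B, ∀ X Y, Γ' X Y = Γ X Y) ∧
  (∀ (b c : B) (X Y : L), Γ (st.s b * (st.t c * X)) Y = b * Γ X Y * c) ∧
  (∀ (b c : B) (X Y : L), Γ (X * st.s b * st.t c) Y = Γ X (st.s b * (st.t c * Y)))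

/-- An invertible normalised 2-cocycle on a left bialgebroid (Definition 2.6);
the collection of these is `Z²(L,B)`. -/
structure IsZ2 (Γ : L → L → B) : Prop where
  bihom : st.IsBihom Γ
  norm_left : ∀ X : L, Γ 1 X = cou X
  norm_right : ∀ X : L, Γ X 1 = cou X
  st_indep : ∀ (b : B) (X Y : L), Γ X (Y * st.s b) = Γ X (Y * st.t b)
  cocycle : ∀ X Y Z : L, st.cocL cop Γ X Y Z = st.cocR cop Γ X Y Z
  inv : ∃ Γi : L → L → B, st.IsBihom Γi ∧
    (∀ X Y, st.conv2 cop Γ Γi X Y = unit2 cou X Y) ∧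
    (∀ X Y, st.conv2 cop Γi Γ X Y = unit2 cou X Y)

/-- The coboundary `∂U(X,Y) = U⁻¹(X₍₁₎ t(U⁻¹(Y₍₁₎))) U(X₍₂₎Y₍₂₎)` of `U ∈ C¹(L,B)`. -/
def coboundary (U Ui : L →ₗ[k] B) (X Y : L) : B :=
  st.lift2 (fun y1 y2 =>
    st.lift2 (fun x1 x2 => Ui (x1 * st.t (Ui y1)) * U (x2 * y2)) (cop X)) (cop Y)

/-- The transform `Γ^U(X,Y) = U⁻¹(X₍₁₎ t(U⁻¹(Y₍₁₎))) Γ(X₍₂₎,Y₍₂₎) U(X₍₃₎Y₍₃₎)`. -/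
def gammaU (Γ : L → L → B) (U Ui : L →ₗ[k] B) (X Y : L) : B :=
  st.lift2 (fun y1 y23 => st.lift2 (fun y2 y3 =>
    st.lift2 (fun x1 x23 => st.lift2 (fun x2 x3 =>
      Ui (x1 * st.t (Ui y1)) * Γ x2 y2 * U (x3 * y3)) (cop x23)) (cop X))
    (cop y23)) (cop Y)

/-- The cotwisted product `X ·_Γ Y := s(Γ(X₍₁₎,Y₍₁₎)) t(Γ⁻¹(X₍₃₎,Y₍₃₎)) X₍₂₎Y₍₂₎`. -/
def prodG (Γ Γi : L → L → B) (X Y : L) : L :=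
  st.lift2 (fun y1 y23 => st.lift2 (fun y2 y3 =>
    st.lift2 (fun x1 x23 => st.lift2 (fun x2 x3 =>
      st.s (Γ x1 y1) * (st.t (Γi x3 y3) * (x2 * y2))) (cop x23)) (cop X))
    (cop y23)) (cop Y)

/-- `Ad_U(X) := s(U(X₍₁₎)) t(U⁻¹(X₍₃₎)) X₍₂₎`. -/
def adU (U Ui : L →ₗ[k] B) (X : L) : L :=
  st.lift2 (fun x1 x23 => st.lift2 (fun x2 x3 =>
    st.s (U x1) * (st.t (Ui x3) * x2)) (cop x23)) (cop X)

end BgdST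

end

noncomputable section

namespace BgdST

variable {k : Type*} [Field k] {B L : Type*} [Ring B] [Algebra k B] [Ring L] [Algebra k L]
variable {st : BgdST k B L} {cop : L →ₗ[k] st.T2} {cou : L →ₗ[k] B}
variable {Q : Type*} [AddCommGroup Q] [Module k Q]

theorem mk2_induction {P : st.T2 → Prop} (mk : ∀ x y, P (st.mk2 x y))
    (add : ∀ z w, P z → P w → P (z + w)) (z : st.T2) : P z := by
  obtain ⟨r, rfl⟩ := Submodule.Quotient.mk_surjective _ z
  induction r using TensorProduct.induction_on with
  | zero => simpa [mk2] using mk 0 0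
  | tmul x y => exact mk x y
  | add z w hz hw => exact add _ _ hz hw

theorem linearMap_ext_mk2 {F G : st.T2 →ₗ[k] Q}
    (h : ∀ x y, F (st.mk2 x y) = G (st.mk2 x y)) : F = G := by
  refine LinearMap.ext fun z => ?_
  induction z using mk2_induction with
  | mk x y => exact h x y
  | add z w hz hw => rw [map_add, map_add, hz, hw]

theorem mk2_balanced (a : B) (x y : L) : st.mk2 (st.t a * x) y = st.mk2 x (st.s a * y) :=
  (Submodule.Quotient.eq _).2 (Submodule.subset_span ⟨a, x, y, rfl⟩)

/-- The bilinear map underlying `BgdST.mk2`. -/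
def mk2Bilin (st : BgdST k B L) : L →ₗ[k] L →ₗ[k] st.T2 :=
  (TensorProduct.mk k L L).compr₂ st.rel.mkQ

theorem lift2_eq {f : L → L → Q} (G : st.T2 →ₗ[k] Q) (h : ∀ x y, G (st.mk2 x y) = f x y) :
    st.lift2 f = G := by
  have hex : ∃ F : st.T2 →ₗ[k] Q, ∀ x y, F (Submodule.Quotient.mk (x ⊗ₜ[k] y)) = f x y :=
    ⟨G, h⟩
  have hl : st.lift2 f = hex.choose := dif_pos hex
  rw [hl]
  exact linearMap_ext_mk2 fun x y => (hex.choose_spec x y).trans (h x y).symm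

/-- If `lift2 f` is not the junk value `0`, then it computes `f` on pure tensors. -/
theorem lift2_mk2_of_ne_zero {f : L → L → Q} (h : st.lift2 f ≠ 0) (x y : L) :
    st.lift2 f (st.mk2 x y) = f x y := by
  by_cases hex : ∃ F : st.T2 →ₗ[k] Q, ∀ x y, F (Submodule.Quotient.mk (x ⊗ₜ[k] y)) = f x y
  · have hl : st.lift2 f = hex.choose := dif_pos hex
    rw [hl]
    exact hex.choose_spec x y
  · exact absurd (dif_neg hex) h

/-- A `B`-balanced `k`-bilinear map factors through `L ⊗_B L`. -/
theorem lift2_mk2 (f : L → L → Q) (F : L →ₗ[k] L →ₗ[k] Q) (hF : ∀ x y, F x y = f x y)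
    (bal : ∀ a x y, f (st.t a * x) y = f x (st.s a * y)) (x y : L) :
    st.lift2 f (st.mk2 x y) = f x y := by
  have hle : st.rel ≤ LinearMap.ker (TensorProduct.lift F) := by
    refine Submodule.span_le.2 ?_
    rintro _ ⟨a, x, y, rfl⟩
    simp [hF, bal]
  rw [lift2_eq (st.rel.liftQ (TensorProduct.lift F) hle) fun x y => ?_]
  · exact hF x y
  · exact hF x y

theorem lift2_mk2_mul_mul (p q x y : L) :
    st.lift2 (fun x y => st.mk2 (x * p) (y * q)) (st.mk2 x y) = st.mk2 (x * p) (y * q) :=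
  lift2_mk2 (fun x y => st.mk2 (x * p) (y * q))
    (st.mk2Bilin.compl₁₂ (LinearMap.mulRight k p) (LinearMap.mulRight k q))
    (fun _ _ => rfl) (fun a x y => by simp only [mul_assoc, mk2_balanced]) x y

theorem lift2_mk2_mul_left (p x y : L) :
    st.lift2 (fun x y => st.mk2 (x * p) y) (st.mk2 x y) = st.mk2 (x * p) y := by
  simpa using lift2_mk2_mul_mul (st := st) p 1 x y

theorem lift2_mk2_mul_right (q x y : L) :
    st.lift2 (fun x y => st.mk2 x (y * q)) (st.mk2 x y) = st.mk2 x (y * q) := by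
  simpa using lift2_mk2_mul_mul (st := st) 1 q x y

theorem lift2_mk2_s_mul (b : B) (x y : L) :
    st.lift2 (fun x y => st.mk2 (st.s b * x) y) (st.mk2 x y) = st.mk2 (st.s b * x) y :=
  lift2_mk2 (fun x y => st.mk2 (st.s b * x) y)
    (st.mk2Bilin.compl₁₂ (LinearMap.mulLeft k (st.s b)) LinearMap.id)
    (fun _ _ => rfl)
    (fun a x y => by
      simp only [← mul_assoc, st.st_comm]
      simp only [mul_assoc, mk2_balanced]) x y

theorem lift2_mk2_t_mul (b : B) (x y : L) :
    st.lift2 (fun x y => st.mk2 x (st.t b * y)) (st.mk2 x y) = st.mk2 x (st.t b * y) :=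
  lift2_mk2 (fun x y => st.mk2 x (st.t b * y))
    (st.mk2Bilin.compl₁₂ LinearMap.id (LinearMap.mulLeft k (st.t b)))
    (fun _ _ => rfl)
    (fun a x y => by
      simp only [mk2_balanced, ← mul_assoc, st.st_comm]) x y

theorem lift2_bimod {U V : L →ₗ[k] B} (hU : ∀ (b : B) (X : L), U (st.t b * X) = U X * b)
    (hV : ∀ (b : B) (X : L), V (st.s b * X) = b * V X) (x y : L) :
    st.lift2 (fun x y => U x * V y) (st.mk2 x y) = U x * V y :=
  lift2_mk2 (fun x y => U x * V y)
    ((LinearMap.mul k B).compl₁₂ U V) (fun _ _ => rfl)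
    (fun a x y => by rw [hU, hV, mul_assoc]) x y

theorem mk_mul_tmul (r : L ⊗[k] L) (p q : L) :
    (Submodule.Quotient.mk (r * p ⊗ₜ[k] q) : st.T2) =
      st.lift2 (fun x y => st.mk2 (x * p) (y * q)) (Submodule.Quotient.mk r) := by
  induction r using TensorProduct.induction_on with
  | zero => simp
  | tmul x y =>
    rw [Algebra.TensorProduct.tmul_mul_tmul]
    exact (lift2_mk2_mul_mul p q x y).symm
  | add z w hz hw => rw [add_mul, Submodule.Quotient.mk_add, Submodule.Quotient.mk_add,
      map_add, hz, hw]

/-- The trilinear map underlying `BgdST.mk3`. -/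
def mk3Trilin (st : BgdST k B L) : L →ₗ[k] L ⊗[k] L →ₗ[k] st.T3 :=
  (TensorProduct.mk k L (L ⊗[k] L)).compr₂ st.rel3.mkQ

theorem mk3_eq (x y z : L) : st.mk3 x y z = st.mk3Trilin x (TensorProduct.mk k L L y z) := rfl

theorem mk3_balanced_left (a : B) (x y z : L) :
    st.mk3 (st.t a * x) y z = st.mk3 x (st.s a * y) z :=
  (Submodule.Quotient.eq _).2 (Submodule.subset_span (Or.inl ⟨a, x, y, z, rfl⟩))

theorem mk3_balanced_right (a : B) (x y z : L) :
    st.mk3 x (st.t a * y) z = st.mk3 x y (st.s a * z) :=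
  (Submodule.Quotient.eq _).2 (Submodule.subset_span (Or.inr ⟨a, x, y, z, rfl⟩))

theorem lift2_mk3_right (x y z : L) :
    st.lift2 (fun y z => st.mk3 x y z) (st.mk2 y z) = st.mk3 x y z :=
  lift2_mk2 (fun y z => st.mk3 x y z)
    ((TensorProduct.mk k L L).compr₂ (st.mk3Trilin x)) (fun _ _ => rfl)
    (fun a y z => mk3_balanced_right a x y z) y z

theorem lift2_mk3_left (x y z : L) :
    st.lift2 (fun x y => st.mk3 x y z) (st.mk2 x y) = st.mk3 x y z :=
  lift2_mk2 (fun x y => st.mk3 x y z)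
    (st.mk3Trilin.compl₁₂ LinearMap.id ((TensorProduct.mk k L L).flip z))
    (fun _ _ => rfl) (fun a x y => mk3_balanced_left a x y z) x y

theorem exists_linearMap_mk3 {U V W : L →ₗ[k] B} (hU : st.IsBimodMap U) (hV : st.IsBimodMap V)
    (hW : st.IsBimodMap W) :
    ∃ F : st.T3 →ₗ[k] B, ∀ x y z, F (st.mk3 x y z) = U x * (V y * W z) := by
  let G : L ⊗[k] (L ⊗[k] L) →ₗ[k] B := TensorProduct.lift ((LinearMap.mul k B).compl₁₂ U
    (TensorProduct.lift ((LinearMap.mul k B).compl₁₂ V W)))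
  have hG : ∀ x y z, G (x ⊗ₜ[k] (y ⊗ₜ[k] z)) = U x * (V y * W z) := fun _ _ _ => rfl
  have hle : st.rel3 ≤ LinearMap.ker G := by
    refine Submodule.span_le.2 ?_
    rintro _ (⟨a, x, y, z, rfl⟩ | ⟨a, x, y, z, rfl⟩)
    · simp only [SetLike.mem_coe, LinearMap.mem_ker, map_sub, hG, hU.1, hV.2, mul_assoc, sub_self]
    · simp only [SetLike.mem_coe, LinearMap.mem_ker, map_sub, hG, hV.1, hW.2, mul_assoc, sub_self]
  exact ⟨st.rel3.liftQ G hle, hG⟩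

theorem IsBimodMap.comp_mulRight {U : L →ₗ[k] B} (hU : st.IsBimodMap U) (p : L) :
    st.IsBimodMap (U ∘ₗ LinearMap.mulRight k p) := by
  refine ⟨fun b X => ?_, fun b X => ?_⟩
  · simp only [LinearMap.comp_apply, LinearMap.mulRight_apply, mul_assoc, hU.1]
  · simp only [LinearMap.comp_apply, LinearMap.mulRight_apply, mul_assoc, hU.2]

namespace IsLeftBialgebroid

variable (h : st.IsLeftBialgebroid cop cou)
include h

theorem comul_mul_balanced (a : B) (Z p q : L) :
    st.lift2 (fun x y => st.mk2 (x * (st.t a * p)) (y * q)) (cop Z) =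
      st.lift2 (fun x y => st.mk2 (x * p) (y * (st.s a * q))) (cop Z) := by
  have h1 : ∀ z : st.T2, st.lift2 (fun x y => st.mk2 (x * (st.t a * p)) (y * q)) z =
      st.lift2 (fun x y => st.mk2 (x * p) (y * q))
        (st.lift2 (fun x y => st.mk2 (x * st.t a) y) z) := by
    intro z
    induction z using mk2_induction with
    | mk x y => simp only [lift2_mk2_mul_mul, lift2_mk2_mul_left, mul_assoc]
    | add z w hz hw => simp only [map_add, hz, hw]
  have h2 : ∀ z : st.T2, st.lift2 (fun x y => st.mk2 (x * p) (y * (st.s a * q))) z =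
      st.lift2 (fun x y => st.mk2 (x * p) (y * q))
        (st.lift2 (fun x y => st.mk2 x (y * st.s a)) z) := by
    intro z
    induction z using mk2_induction with
    | mk x y => simp only [lift2_mk2_mul_mul, lift2_mk2_mul_right, mul_assoc]
    | add z w hz hw => simp only [map_add, hz, hw]
  rw [h1, h2, h.takeuchi]

theorem mk_mul_eq_zero {Z : L} {r w : L ⊗[k] L}
    (hr : (Submodule.Quotient.mk r : st.T2) = cop Z) (hw : w ∈ st.rel) :
    (Submodule.Quotient.mk (r * w) : st.T2) = 0 := by
  induction hw using Submodule.span_induction with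
  | mem w hw =>
    obtain ⟨a, p, q, rfl⟩ := hw
    rw [mul_sub, Submodule.Quotient.mk_sub, mk_mul_tmul, mk_mul_tmul, hr,
      h.comul_mul_balanced, sub_self]
  | zero => simp
  | add v w _ _ hv hw => rw [mul_add, Submodule.Quotient.mk_add, hv, hw, add_zero]
  | smul c w _ hw => rw [mul_smul_comm, Submodule.Quotient.mk_smul, hw, smul_zero]

theorem mulT2_mk2 (Z p q : L) :
    st.mulT2 (cop Z) (st.mk2 p q) =
      st.lift2 (fun x y => st.mk2 (x * p) (y * q)) (cop Z) := by
  have key : ∀ r w : L ⊗[k] L, Submodule.Quotient.mk r = cop Z →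
      Submodule.Quotient.mk w = st.mk2 p q →
      (Submodule.Quotient.mk (r * w) : st.T2) =
        st.lift2 (fun x y => st.mk2 (x * p) (y * q)) (cop Z) := by
    intro r w hr hw
    have hz := h.mk_mul_eq_zero hr ((Submodule.Quotient.eq _).1 hw)
    rw [mul_sub, Submodule.Quotient.mk_sub, sub_eq_zero] at hz
    rw [hz, mk_mul_tmul, hr]
  have hex : ∃ u : st.T2, ∀ r w : L ⊗[k] L, Submodule.Quotient.mk r = cop Z →
      Submodule.Quotient.mk w = st.mk2 p q → Submodule.Quotient.mk (r * w) = u := ⟨_, key⟩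
  have hm : st.mulT2 (cop Z) (st.mk2 p q) = hex.choose := dif_pos hex
  obtain ⟨r, hr⟩ := Submodule.Quotient.mk_surjective _ (cop Z)
  rw [hm, ← hex.choose_spec r (p ⊗ₜ[k] q) hr rfl, key r _ hr rfl]

theorem comul_mul_s (b : B) (X : L) :
    cop (X * st.s b) = st.lift2 (fun x y => st.mk2 (x * st.s b) y) (cop X) := by
  have hs : cop (st.s b) = st.mk2 (st.s b) 1 := by
    simpa only [mul_one, h.comul_one, lift2_mk2_s_mul] using h.comul_s b 1
  rw [h.comul_mul, hs, h.mulT2_mk2]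
  simp only [mul_one]

theorem comul_mul_t (b : B) (X : L) :
    cop (X * st.t b) = st.lift2 (fun x y => st.mk2 x (y * st.t b)) (cop X) := by
  have ht : cop (st.t b) = st.mk2 1 (st.t b) := by
    simpa only [mul_one, h.comul_one, lift2_mk2_t_mul] using h.comul_t b 1
  rw [h.comul_mul, ht, h.mulT2_mk2]
  simp only [mul_one]

theorem isBimodMap_counit : st.IsBimodMap cou := ⟨h.counit_t, h.counit_s⟩

theorem isBimodMap_cconv {U V : L →ₗ[k] B} (hU : st.IsBimodMap U) (hV : st.IsBimodMap V) :
    st.IsBimodMap (st.cconv cop U V) := by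
  refine ⟨fun b X => ?_, fun b X => ?_⟩
  · simp only [cconv, LinearMap.comp_apply, h.comul_t]
    induction cop X using mk2_induction with
    | mk x y => simp only [lift2_mk2_t_mul, lift2_bimod hU.1 hV.2, hV.1, mul_assoc]
    | add z w hz hw => simp only [map_add, hz, hw, add_mul]
  · simp only [cconv, LinearMap.comp_apply, h.comul_s]
    induction cop X using mk2_induction with
    | mk x y => simp only [lift2_mk2_s_mul, lift2_bimod hU.1 hV.2, hU.2, mul_assoc]
    | add z w hz hw => simp only [map_add, hz, hw, mul_add]

theorem cconv_one {U V : L →ₗ[k] B} (hU : st.IsBimodMap U) (hV : st.IsBimodMap V) :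
    st.cconv cop U V 1 = U 1 * V 1 := by
  rw [cconv, LinearMap.comp_apply, h.comul_one, lift2_bimod hU.1 hV.2]

theorem cconv_counit {U : L →ₗ[k] B} (hU : st.IsBimodMap U) : st.cconv cop U cou = U := by
  ext X
  have hz : ∀ z : st.T2, st.lift2 (fun x y => U x * cou y) z =
      U (st.lift2 (fun x y => st.t (cou y) * x) z) := by
    intro z
    induction z using mk2_induction with
    | mk x y =>
      rw [lift2_bimod hU.1 h.counit_s, lift2_mk2
        (fun x y => st.t (cou y) * x)
        ((LinearMap.mul k L).flip.compl₁₂ LinearMap.id (st.t ∘ₗ cou)) (fun _ _ => rfl)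
        (fun a x y => by rw [h.counit_s, st.t_mul, mul_assoc]), hU.1]
    | add z w hz hw => simp only [map_add, hz, hw]
  rw [cconv, LinearMap.comp_apply, hz, h.counit_comul_right]

theorem counit_cconv {U : L →ₗ[k] B} (hU : st.IsBimodMap U) : st.cconv cop cou U = U := by
  ext X
  have hz : ∀ z : st.T2, st.lift2 (fun x y => cou x * U y) z =
      U (st.lift2 (fun x y => st.s (cou x) * y) z) := by
    intro z
    induction z using mk2_induction with
    | mk x y =>
      rw [lift2_bimod h.counit_t hU.2, lift2_mk2
        (fun x y => st.s (cou x) * y)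
        ((LinearMap.mul k L).compl₁₂ (st.s.toLinearMap ∘ₗ cou) LinearMap.id) (fun _ _ => rfl)
        (fun a x y => by rw [h.counit_t, map_mul, mul_assoc]), hU.2]
    | add z w hz hw => simp only [map_add, hz, hw]
  rw [cconv, LinearMap.comp_apply, hz, h.counit_comul_left]

theorem cconv_assoc {U V W : L →ₗ[k] B} (hU : st.IsBimodMap U) (hV : st.IsBimodMap V)
    (hW : st.IsBimodMap W) :
    st.cconv cop (st.cconv cop U V) W = st.cconv cop U (st.cconv cop V W) := by
  ext X
  obtain ⟨F, hF⟩ := exists_linearMap_mk3 hU hV hW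
  have hUV := h.isBimodMap_cconv hU hV
  have hVW := h.isBimodMap_cconv hV hW
  have hr : ∀ z : st.T2,
      F (st.lift2 (fun x1 x2 => st.lift2 (fun y1 y2 => st.mk3 x1 y1 y2) (cop x2)) z) =
        st.lift2 (fun x y => U x * st.cconv cop V W y) z := by
    intro z
    induction z using mk2_induction with
    | mk x y =>
      rw [lift2_bimod hU.1 hVW.2, lift2_mk2
        (fun x1 x2 => st.lift2 (fun y1 y2 => st.mk3 x1 y1 y2) (cop x2)) (LinearMap.mk₂ k
        (fun x1 x2 => st.lift2 (fun y1 y2 => st.mk3 x1 y1 y2) (cop x2))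
        (fun x x' y => ?_) (fun c x y => ?_) (fun x y y' => ?_) (fun c x y => ?_))
        (fun _ _ => rfl) (fun a x y => ?_), cconv, LinearMap.comp_apply]
      · induction cop y using mk2_induction with
        | mk y z => simp only [lift2_mk3_right, lift2_bimod hV.1 hW.2, hF]
        | add z w hz hw => simp only [map_add, hz, hw, mul_add]
      · induction cop y using mk2_induction with
        | mk y z =>
          simp only [lift2_mk3_right]
          simp only [mk3_eq, map_add, LinearMap.add_apply]
        | add z w hz hw => simp only [map_add, hz, hw]; abel
      · induction cop y using mk2_induction with
        | mk y z =>
          simp only [lift2_mk3_right]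
          simp only [mk3_eq, map_smul, LinearMap.smul_apply]
        | add z w hz hw => simp only [map_add, hz, hw, smul_add]
      · simp only [map_add]
      · simp only [map_smul]
      · rw [h.comul_s]
        induction cop y using mk2_induction with
        | mk y z =>
          simp only [lift2_mk2_s_mul, lift2_mk3_right]
          exact mk3_balanced_left a x y z
        | add z w hz hw => simp only [map_add, hz, hw]
    | add z w hz hw => simp only [map_add, hz, hw]
  have hl : ∀ z : st.T2,
      F (st.lift2 (fun x12 x3 => st.lift2 (fun x1 x2 => st.mk3 x1 x2 x3) (cop x12)) z) =
        st.lift2 (fun x y => st.cconv cop U V x * W y) z := by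
    intro z
    induction z using mk2_induction with
    | mk x y =>
      rw [lift2_bimod hUV.1 hW.2, lift2_mk2
        (fun x12 x3 => st.lift2 (fun x1 x2 => st.mk3 x1 x2 x3) (cop x12)) (LinearMap.mk₂ k
        (fun x12 x3 => st.lift2 (fun x1 x2 => st.mk3 x1 x2 x3) (cop x12))
        (fun x x' y => ?_) (fun c x y => ?_) (fun x y y' => ?_) (fun c x y => ?_))
        (fun _ _ => rfl) (fun a x y => ?_), cconv, LinearMap.comp_apply]
      · induction cop x using mk2_induction with
        | mk x z => simp only [lift2_mk3_left, lift2_bimod hU.1 hV.2, hF, mul_assoc]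
        | add z w hz hw => simp only [map_add, hz, hw, add_mul]
      · simp only [map_add]
      · simp only [map_smul]
      · induction cop x using mk2_induction with
        | mk x z =>
          simp only [lift2_mk3_left]
          simp only [mk3_eq, map_add]
        | add z w hz hw => simp only [map_add, hz, hw]; abel
      · induction cop x using mk2_induction with
        | mk x z =>
          simp only [lift2_mk3_left]
          simp only [mk3_eq, map_smul]
        | add z w hz hw => simp only [map_add, hz, hw, smul_add]
      · rw [h.comul_t]
        induction cop x using mk2_induction with
        | mk x z =>
          simp only [lift2_mk2_t_mul, lift2_mk3_left]
          exact mk3_balanced_right a x z y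
        | add z w hz hw => simp only [map_add, hz, hw]
    | add z w hz hw => simp only [map_add, hz, hw]
  rw [cconv, LinearMap.comp_apply, ← hl, ← h.coassoc, hr]
  rfl

theorem cconv_mul_s {U V : L →ₗ[k] B} (hU : st.IsBimodMap U) (hV : st.IsBimodMap V) (b : B) :
    st.cconv cop U V ∘ₗ LinearMap.mulRight k (st.s b) =
      st.cconv cop (U ∘ₗ LinearMap.mulRight k (st.s b)) V := by
  ext X
  simp only [cconv, LinearMap.comp_apply, LinearMap.mulRight_apply, h.comul_mul_s]
  induction cop X using mk2_induction with
  | mk x y =>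
    rw [lift2_mk2_mul_left, lift2_bimod hU.1 hV.2]
    exact (lift2_bimod (hU.comp_mulRight _).1 hV.2 x y).symm
  | add z w hz hw => simp only [map_add, hz, hw]

theorem cconv_mul_t {U V : L →ₗ[k] B} (hU : st.IsBimodMap U) (hV : st.IsBimodMap V) (b : B) :
    st.cconv cop U V ∘ₗ LinearMap.mulRight k (st.t b) =
      st.cconv cop U (V ∘ₗ LinearMap.mulRight k (st.t b)) := by
  ext X
  simp only [cconv, LinearMap.comp_apply, LinearMap.mulRight_apply, h.comul_mul_t]
  induction cop X using mk2_induction with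
  | mk x y =>
    rw [lift2_mk2_mul_right, lift2_bimod hU.1 hV.2]
    exact (lift2_bimod hU.1 (hV.comp_mulRight _).2 x y).symm
  | add z w hz hw => simp only [map_add, hz, hw]

theorem cconv_takeuchi {U V : L →ₗ[k] B} (hU : st.IsBimodMap U) (hV : st.IsBimodMap V) (b : B) :
    st.cconv cop (U ∘ₗ LinearMap.mulRight k (st.t b)) V =
      st.cconv cop U (V ∘ₗ LinearMap.mulRight k (st.s b)) := by
  have hl : ∀ z : st.T2, st.lift2 (fun x y => U (x * st.t b) * V y) z =
      st.lift2 (fun x y => U x * V y) (st.lift2 (fun x y => st.mk2 (x * st.t b) y) z) := by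
    intro z
    induction z using mk2_induction with
    | mk x y =>
      rw [lift2_mk2_mul_left, lift2_bimod hU.1 hV.2]
      exact lift2_bimod (hU.comp_mulRight _).1 hV.2 x y
    | add z w hz hw => simp only [map_add, hz, hw]
  have hr : ∀ z : st.T2, st.lift2 (fun x y => U x * V (y * st.s b)) z =
      st.lift2 (fun x y => U x * V y) (st.lift2 (fun x y => st.mk2 x (y * st.s b)) z) := by
    intro z
    induction z using mk2_induction with
    | mk x y =>
      rw [lift2_mk2_mul_right, lift2_bimod hU.1 hV.2]
      exact lift2_bimod hU.1 (hV.comp_mulRight _).2 x y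
    | add z w hz hw => simp only [map_add, hz, hw]
  ext X
  simp only [cconv, LinearMap.comp_apply, LinearMap.mulRight_apply]
  rw [hl, hr, h.takeuchi]

theorem counit_mul_s_eq_mul_t (b : B) (X : L) : cou (X * st.s b) = cou (X * st.t b) := by
  have hb : cou (st.s b) = b := by
    simpa only [mul_one, h.counit_one] using h.counit_s b 1
  simpa only [hb] using (h.counit_char_t X (st.s b)).symm

theorem cconv_mul_s_eq_mul_t {U V : L →ₗ[k] B} (hU : st.IsBimodMap U) (hV : st.IsBimodMap V)
    (hUst : ∀ (b : B) (X : L), U (X * st.s b) = U (X * st.t b))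
    (hVst : ∀ (b : B) (X : L), V (X * st.s b) = V (X * st.t b)) (b : B) (X : L) :
    st.cconv cop U V (X * st.s b) = st.cconv cop U V (X * st.t b) := by
  have hUb : U ∘ₗ LinearMap.mulRight k (st.s b) = U ∘ₗ LinearMap.mulRight k (st.t b) :=
    LinearMap.ext (hUst b)
  have hVb : V ∘ₗ LinearMap.mulRight k (st.s b) = V ∘ₗ LinearMap.mulRight k (st.t b) :=
    LinearMap.ext (hVst b)
  have : st.cconv cop U V ∘ₗ LinearMap.mulRight k (st.s b) =
      st.cconv cop U V ∘ₗ LinearMap.mulRight k (st.t b) := by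
    rw [h.cconv_mul_s hU hV, hUb, h.cconv_takeuchi hU hV, hVb, h.cconv_mul_t hU hV]
  exact LinearMap.congr_fun this X

theorem inv_mul_s_eq_mul_t {U V : L →ₗ[k] B} (hU : st.IsBimodMap U) (hV : st.IsBimodMap V)
    (hUst : ∀ (b : B) (X : L), U (X * st.s b) = U (X * st.t b))
    (hUV : st.cconv cop U V = cou) (hVU : st.cconv cop V U = cou) (b : B) (X : L) :
    V (X * st.s b) = V (X * st.t b) := by
  have hUb : U ∘ₗ LinearMap.mulRight k (st.s b) = U ∘ₗ LinearMap.mulRight k (st.t b) :=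
    LinearMap.ext (hUst b)
  have hcou : cou ∘ₗ LinearMap.mulRight k (st.s b) = cou ∘ₗ LinearMap.mulRight k (st.t b) :=
    LinearMap.ext (h.counit_mul_s_eq_mul_t b)
  have hVs := hV.comp_mulRight (st.s b)
  have hVt := hV.comp_mulRight (st.t b)
  have hconv : st.cconv cop (V ∘ₗ LinearMap.mulRight k (st.s b)) U =
      st.cconv cop (V ∘ₗ LinearMap.mulRight k (st.t b)) U := by
    rw [← h.cconv_mul_s hV hU, h.cconv_takeuchi hV hU, hUb, ← h.cconv_mul_t hV hU, hVU, hcou]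
  have : V ∘ₗ LinearMap.mulRight k (st.s b) = V ∘ₗ LinearMap.mulRight k (st.t b) := by
    rw [← h.cconv_counit hVs, ← h.cconv_counit hVt, ← hUV, ← h.cconv_assoc hVs hU hV,
      ← h.cconv_assoc hVt hU hV, hconv]
  exact LinearMap.congr_fun this X

theorem isC1_counit : st.IsC1 cop cou cou :=
  ⟨h.counit_one, h.isBimodMap_counit, h.counit_mul_s_eq_mul_t, cou, h.isBimodMap_counit,
    h.cconv_counit h.isBimodMap_counit, h.cconv_counit h.isBimodMap_counit⟩

theorem cconv_cconv_cancel {U V U' V' : L →ₗ[k] B} (hU : st.IsBimodMap U)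
    (hV : st.IsBimodMap V) (hU' : st.IsBimodMap U') (hV' : st.IsBimodMap V')
    (hUU' : st.cconv cop U U' = cou) (hVV' : st.cconv cop V V' = cou) :
    st.cconv cop (st.cconv cop U V) (st.cconv cop V' U') = cou := by
  rw [h.cconv_assoc hU hV (h.isBimodMap_cconv hV' hU'), ← h.cconv_assoc hV hV' hU', hVV',
    h.counit_cconv hU', hUU']

theorem isC1_cconv {U V : L →ₗ[k] B} (hU : st.IsC1 cop cou U) (hV : st.IsC1 cop cou V) :
    st.IsC1 cop cou (st.cconv cop U V) := by
  obtain ⟨hU1, hUb, hUst, U', hU'b, hUU', hU'U⟩ := hU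
  obtain ⟨hV1, hVb, hVst, V', hV'b, hVV', hV'V⟩ := hV
  refine ⟨by rw [h.cconv_one hUb hVb, hU1, hV1, one_mul], h.isBimodMap_cconv hUb hVb,
    h.cconv_mul_s_eq_mul_t hUb hVb hUst hVst, st.cconv cop V' U', h.isBimodMap_cconv hV'b hU'b,
    h.cconv_cconv_cancel hUb hVb hU'b hV'b hUU' hVV',
    h.cconv_cconv_cancel hV'b hU'b hVb hUb hV'V hU'U⟩

theorem isC1_inv {U V : L →ₗ[k] B} (hU : st.IsC1 cop cou U) (hV : st.IsBimodMap V)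
    (hUV : st.cconv cop U V = cou) (hVU : st.cconv cop V U = cou) : st.IsC1 cop cou V := by
  obtain ⟨hU1, hUb, hUst, -⟩ := hU
  refine ⟨?_, hV, h.inv_mul_s_eq_mul_t hUb hV hUst hUV hVU, U, hUb, hVU, hUV⟩
  simpa only [hUV, h.counit_one, hU1, one_mul] using (h.cconv_one hUb hV).symm

/-- A two-sided convolution inverse of a unital map is automatically a bimodule map: the
convolution products are nonzero only if the underlying expressions are balanced. -/
theorem isBimodMap_of_cconv_eq_counit {U V : L →ₗ[k] B} (hU : st.IsBimodMap U) (hU1 : U 1 = 1)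
    (hUV : st.cconv cop U V = cou) (hVU : st.cconv cop V U = cou) : st.IsBimodMap V := by
  rcases subsingleton_or_nontrivial B with hB | hB
  · exact ⟨fun _ _ => Subsingleton.elim _ _, fun _ _ => Subsingleton.elim _ _⟩
  have hcou : cou ≠ 0 := fun h0 => by
    simpa [h0] using h.counit_one
  have hl : st.lift2 (fun x y => U x * V y) ≠ 0 := fun h0 =>
    hcou (by rw [← hUV, cconv, h0, LinearMap.zero_comp])
  have hr : st.lift2 (fun x y => V x * U y) ≠ 0 := fun h0 =>
    hcou (by rw [← hVU, cconv, h0, LinearMap.zero_comp])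
  refine ⟨fun b X => ?_, fun b X => ?_⟩
  · have hbal := congrArg (st.lift2 fun x y => V x * U y) (mk2_balanced (st := st) b X 1)
    rwa [lift2_mk2_of_ne_zero hr, lift2_mk2_of_ne_zero hr, hU.2, hU1, mul_one, mul_one] at hbal
  · have hbal := congrArg (st.lift2 fun x y => U x * V y) (mk2_balanced (st := st) b 1 X)
    rw [lift2_mk2_of_ne_zero hl, lift2_mk2_of_ne_zero hl, hU.1, hU1, one_mul, one_mul] at hbal
    exact hbal.symm

end IsLeftBialgebroid
end BgdST

end

/-- Let `L` be a left bialgebroid over `B`.  Then `C¹(L,B)`, the set of extended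
vertical bisections, is a group under the convolution product `(U*V)(X) = U(X₍₁₎)V(X₍₂₎)` with
unit the counit `ε`; in particular the convolution inverse `U⁻¹` of any `U ∈ C¹(L,B)` again
satisfies `U⁻¹(t(b)X) = U⁻¹(X)b`, `U⁻¹(s(b)X) = b U⁻¹(X)` and `U⁻¹(X s(b)) = U⁻¹(X t(b))`. -/
theorem extended_vertical_bisections_form_group
    {k : Type*} [Field k] {B L : Type*} [Ring B] [Algebra k B] [Ring L] [Algebra k L]
    (st : BgdST k B L) (cop : L →ₗ[k] st.T2) (cou : L →ₗ[k] B)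
    (hbgd : st.IsLeftBialgebroid cop cou) :
    (∀ U V : L →ₗ[k] B, st.IsC1 cop cou U → st.IsC1 cop cou V →
      st.IsC1 cop cou (st.cconv cop U V)) ∧
    st.IsC1 cop cou cou ∧
    (∀ U V W : L →ₗ[k] B, st.IsC1 cop cou U → st.IsC1 cop cou V → st.IsC1 cop cou W →
      st.cconv cop (st.cconv cop U V) W = st.cconv cop U (st.cconv cop V W)) ∧
    (∀ U : L →ₗ[k] B, st.IsC1 cop cou U →
      st.cconv cop U cou = U ∧ st.cconv cop cou U = U) ∧
    (∀ U : L →ₗ[k] B, st.IsC1 cop cou U → ∃ Ui : L →ₗ[k] B,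
      st.IsC1 cop cou Ui ∧ st.cconv cop U Ui = cou ∧ st.cconv cop Ui U = cou) ∧
    (∀ U Ui : L →ₗ[k] B, st.IsC1 cop cou U →
      st.cconv cop U Ui = cou → st.cconv cop Ui U = cou →
      (∀ (b : B) (X : L), Ui (st.t b * X) = Ui X * b) ∧
      (∀ (b : B) (X : L), Ui (st.s b * X) = b * Ui X) ∧
      (∀ (b : B) (X : L), Ui (X * st.s b) = Ui (X * st.t b))) := by
  refine ⟨fun U V => hbgd.isC1_cconv, hbgd.isC1_counit,
    fun U V W hU hV hW => hbgd.cconv_assoc hU.2.1 hV.2.1 hW.2.1,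
    fun U hU => ⟨hbgd.cconv_counit hU.2.1, hbgd.counit_cconv hU.2.1⟩, fun U hU => ?_,
    fun U V hU hUV hVU => ?_⟩
  · obtain ⟨V, hV, hUV, hVU⟩ := hU.2.2.2
    exact ⟨V, hbgd.isC1_inv hU hV hUV hVU, hUV, hVU⟩
  · have hV := hbgd.isBimodMap_of_cconv_eq_counit hU.2.1 hU.1 hUV hVU
    exact ⟨hV.1, hV.2, (hbgd.isC1_inv hU hV hUV hVU).2.2.1⟩
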